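/- Let D be a finite-dimensional division algebra over a real-closed field R contained in D. Then every element of SLₙ(D) is a product of two squares of elements of GLₙ(D). -/

import Mathlib

open Polynomial

universe u

section

variable {Ω : Type*} [Field Ω] [IsAlgClosed Ω] [CharZero Ω] {F : Type*} [Field F] [Algebra F Ω]

/-- An automorphism of prime order of an algebraically closed field moves the square roots of
`-1`. -/
lemma AlgEquiv.orderOf_ne_prime_of_fix {σ : Ω ≃ₐ[F] Ω} {i : Ω} (hi : i * i = -1) (hσi : σ i = i)
    {p : ℕ} (hp : p.Prime) : orderOf σ ≠ p := by
  intro hσ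
  have : NeZero p := ⟨hp.ne_zero⟩
  obtain ⟨ζ, hζ⟩ := HasEnoughRootsOfUnity.exists_primitiveRoot Ω p
  have hσp : σ ^ p = 1 := hσ ▸ pow_orderOf_eq_one σ
  have hfixζ : σ ζ = ζ := by
    obtain ⟨k, -, hk⟩ := hζ.eq_pow_of_pow_eq_one (ξ := σ ζ) (by rw [← map_pow, hζ.pow_eq_one, map_one])
    have hiter : ∀ n : ℕ, (σ ^ n) ζ = ζ ^ k ^ n := by
      intro n
      induction n with
      | zero => simp
      | succ n ih => rw [pow_succ', AlgEquiv.mul_apply, ih, map_pow, ← hk, ← pow_mul, pow_succ']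
    have h1 : ζ ^ k ^ p = ζ ^ 1 := by rw [← hiter, hσp]; simp
    rw [← hk]
    conv_rhs => rw [← pow_one ζ]
    rw [← h1, hζ.isOfFinOrder hp.ne_zero |>.pow_eq_pow_iff_modEq, ← hζ.eq_orderOf]
    have := Fact.mk hp
    rw [← ZMod.natCast_eq_natCast_iff]
    simp [ZMod.pow_card]
  have hfix : ∀ ω : Ω, ω ^ p = 1 → σ ω = ω := by
    intro ω hω
    obtain ⟨k, -, rfl⟩ := hζ.eq_pow_of_pow_eq_one hω
    rw [map_pow, hfixζ]
  obtain ⟨α, hα0, hα⟩ : ∃ α : Ω, α ≠ 0 ∧ σ α = ζ * α := by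
    have hli : LinearIndependent Ω (fun j : Fin p => (⇑((σ ^ (j : ℕ) : Ω ≃ₐ[F] Ω) : Ω →* Ω) : Ω → Ω)) := by
      refine (linearIndependent_monoidHom Ω Ω).comp
        (fun j : Fin p => ((σ ^ (j : ℕ) : Ω ≃ₐ[F] Ω) : Ω →* Ω)) fun a b hab => ?_
      have h : σ ^ (a : ℕ) = σ ^ (b : ℕ) := AlgEquiv.ext fun x => DFunLike.congr_fun hab x
      exact Fin.ext (pow_injOn_Iio_orderOf (by simp [hσ]) (by simp [hσ]) h)
    have hne : (∑ j : Fin p, (ζ⁻¹ ^ (j : ℕ)) •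
        (⇑((σ ^ (j : ℕ) : Ω ≃ₐ[F] Ω) : Ω →* Ω) : Ω → Ω)) ≠ 0 := by
      intro h0
      have := Fintype.linearIndependent_iff.1 hli _ h0 ⟨0, hp.pos⟩
      simp at this
    obtain ⟨x, hx⟩ := Function.ne_iff.1 hne
    have hsum : (∑ j : Fin p, (ζ⁻¹ ^ (j : ℕ)) •
        (⇑((σ ^ (j : ℕ) : Ω ≃ₐ[F] Ω) : Ω →* Ω) : Ω → Ω)) x =
        ∑ j ∈ Finset.range p, ζ⁻¹ ^ j * (σ ^ j) x := by
      rw [Finset.sum_apply, ← Fin.sum_univ_eq_sum_range (fun j => ζ⁻¹ ^ j * (σ ^ j) x)]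
      simp
    rw [hsum] at hx
    refine ⟨_, hx, ?_⟩
    have hζ0 : ζ ≠ 0 := hζ.ne_zero hp.ne_zero
    have hshift : σ (∑ j ∈ Finset.range p, ζ⁻¹ ^ j * (σ ^ j) x) =
        ζ * ∑ j ∈ Finset.range p, ζ⁻¹ ^ (j + 1) * (σ ^ (j + 1)) x := by
      rw [map_sum, Finset.mul_sum]
      refine Finset.sum_congr rfl fun j _ => ?_
      rw [map_mul, map_pow, map_inv₀, hfixζ, pow_succ' σ, AlgEquiv.mul_apply, pow_succ']
      field_simp
    rw [hshift]
    congr 1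
    have h1 := Finset.sum_range_succ (fun j => ζ⁻¹ ^ j * (σ ^ j) x) p
    rw [Finset.sum_range_succ', hσp, inv_pow ζ p, hζ.pow_eq_one] at h1
    simpa using h1
  obtain ⟨β, hβ⟩ := IsAlgClosed.exists_pow_nat_eq α hp.pos
  have hβ0 : β ≠ 0 := by
    rintro rfl
    exact hα0 (by rw [← hβ, zero_pow hp.ne_zero])
  obtain ⟨u, hu⟩ : ∃ u, σ β = u * β := ⟨σ β / β, by field_simp⟩
  have hup : u ^ p = ζ := by
    have : u ^ p * α = ζ * α := by rw [← hα, ← hβ, ← mul_pow, ← hu, map_pow]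
    exact mul_right_cancel₀ hα0 this
  have hu0 : u ≠ 0 := by
    rintro rfl
    exact hβ0 (by simpa using hu)
  obtain ⟨ω, hω⟩ : ∃ ω, σ u = ω * u := ⟨σ u / u, by field_simp⟩
  have hωp : ω ^ p = 1 := by
    have : ω ^ p * ζ = 1 * ζ := by
      rw [one_mul]
      conv_rhs => rw [← hfixζ, ← hup, map_pow, hω, mul_pow, hup]
    exact mul_right_cancel₀ (hζ.ne_zero hp.ne_zero) this
  have hiter : ∀ n : ℕ, (σ ^ n) β = ω ^ n.choose 2 * u ^ n * β := by
    intro n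
    induction n with
    | zero => simp
    | succ n ih =>
      rw [pow_succ', AlgEquiv.mul_apply, ih, map_mul, map_mul, map_pow, map_pow, hfix ω hωp, hω, hu,
        Nat.choose_succ_succ' n 1, Nat.choose_one_right, pow_add, mul_pow, pow_succ u]
      ring
  have hend := hiter p
  rw [hσp, AlgEquiv.one_apply, hup] at hend
  have hone : ω ^ p.choose 2 * ζ = 1 := mul_right_cancel₀ hβ0 (by rw [← hend, one_mul])
  rcases hp.eq_two_or_odd' with rfl | hodd
  · have hζ1 : ζ = -1 := hζ.eq_neg_one_of_two_right
    have hσu : σ u = u := by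
      have : (u - i) * (u + i) = 0 := by linear_combination hup + hζ1 - hi
      rcases mul_eq_zero.1 this with h | h
      · rw [sub_eq_zero.1 h, hσi]
      · rw [eq_neg_of_add_eq_zero_left h, map_neg, hσi]
    have hω1 : ω = 1 := mul_right_cancel₀ hu0 (by rw [← hω, hσu, one_mul])
    rw [hω1, hζ1, one_pow, one_mul] at hone
    norm_num at hone
  · have h2 : 2 < p := lt_of_le_of_ne hp.two_le fun h => by subst h; exact absurd hodd (by decide)
    obtain ⟨c, hc⟩ := hp.dvd_choose_self two_ne_zero h2
    rw [hc, pow_mul, hωp, one_pow, one_mul] at hone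
    exact hζ.ne_one hp.one_lt hone

lemma AlgEquiv.eq_one_of_isOfFinOrder_of_fix {σ : Ω ≃ₐ[F] Ω} (h : IsOfFinOrder σ) {i : Ω}
    (hi : i * i = -1) (hσi : σ i = i) : σ = 1 := by
  by_contra hne
  obtain ⟨p, hp, hpd⟩ := Nat.exists_prime_and_dvd (mt orderOf_eq_one_iff.1 hne)
  have hfix : ∀ n : ℕ, (σ ^ n) i = i := fun n => by
    induction n with
    | zero => simp
    | succ n ih => rw [pow_succ', AlgEquiv.mul_apply, ih, hσi]
  exact AlgEquiv.orderOf_ne_prime_of_fix hi (hfix _) hp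
    (orderOf_pow_orderOf_div h.orderOf_pos.ne' hpd)

end

/-- If a field `F` of characteristic zero has an algebraically closed finite extension, then each
finite extension of `F` is trivial or algebraically closed. -/
theorem surjective_algebraMap_or_isAlgClosed (F Ω E : Type*) [Field F] [CharZero F] [Field Ω]
    [Algebra F Ω] [FiniteDimensional F Ω] [IsAlgClosed Ω] [Field E] [Algebra F E]
    [FiniteDimensional F E] : Function.Surjective (algebraMap F E) ∨ IsAlgClosed E := by
  have : CharZero Ω := charZero_of_injective_algebraMap (algebraMap F Ω).injective
  have : IsAlgClosure F Ω := ⟨inferInstance, inferInstance⟩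
  have : Normal F Ω := IsAlgClosure.normal F Ω
  have : IsGalois F Ω := ⟨⟩
  obtain ⟨i, hi⟩ := IsAlgClosed.exists_pow_nat_eq (-1 : Ω) two_pos
  rw [pow_two] at hi
  have hmove : ∀ σ : Ω ≃ₐ[F] Ω, σ ≠ 1 → σ i = -i := fun σ hσ => by
    have hne := mt (AlgEquiv.eq_one_of_isOfFinOrder_of_fix (isOfFinOrder_of_finite σ) hi) hσ
    have : (σ i - i) * (σ i + i) = 0 := by
      have h2 : σ i * σ i = -1 := by rw [← map_mul, hi, map_neg, map_one]
      linear_combination h2 - hi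
    exact eq_neg_of_add_eq_zero_left ((mul_eq_zero.1 this).resolve_left (sub_ne_zero.2 hne))
  let φ : E →ₐ[F] Ω := IsAlgClosed.lift
  by_cases htop : φ.fieldRange = ⊤
  · right
    have hsurj : Function.Surjective φ := AlgHom.fieldRange_eq_top.1 htop
    let e : E ≃+* Ω := RingEquiv.ofBijective φ ⟨φ.injective, hsurj⟩
    refine IsAlgClosed.of_exists_root _ fun q hq hirr => ?_
    obtain ⟨x, hx⟩ := IsAlgClosed.exists_eval₂_eq_zero e.toRingHom q hirr.degree_pos.ne'
    refine ⟨e.symm x, e.injective ?_⟩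
    rw [map_zero, ← hx]
    exact (Polynomial.hom_eval₂ q (RingHom.id E) e.toRingHom (e.symm x)).trans (by simp)
  · left
    have hbot : φ.fieldRange = ⊥ := by
      by_contra hbot
      obtain ⟨σ, hσ, hσ1⟩ : ∃ σ ∈ φ.fieldRange.fixingSubgroup, σ ≠ 1 := by
        by_contra! h
        refine htop ?_
        rw [← IsGalois.fixedField_fixingSubgroup φ.fieldRange, (Subgroup.eq_bot_iff_forall _).2 h,
          IntermediateField.fixedField_bot]
      obtain ⟨τ, hτ⟩ : ∃ τ : Ω ≃ₐ[F] Ω, τ ∉ φ.fieldRange.fixingSubgroup := by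
        by_contra! h
        refine hbot ?_
        rw [← IsGalois.fixedField_fixingSubgroup φ.fieldRange, (Subgroup.eq_top_iff' _).2 h,
          ← IntermediateField.fixingSubgroup_bot, IsGalois.fixedField_fixingSubgroup]
      have hτ1 : τ ≠ 1 := fun h => hτ (h ▸ one_mem _)
      have hστ : σ * τ = 1 := by
        by_contra h
        have := hmove _ h
        rw [AlgEquiv.mul_apply, hmove τ hτ1, map_neg, hmove σ hσ1, neg_neg] at this
        have h0 : i = 0 := by linear_combination this / 2
        rw [h0] at hi
        norm_num at hi
      exact hτ (by rw [← inv_eq_of_mul_eq_one_right hστ]; exact inv_mem hσ)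
    intro x
    have : φ x ∈ φ.fieldRange := ⟨x, rfl⟩
    rw [hbot, IntermediateField.mem_bot] at this
    obtain ⟨y, hy⟩ := this
    exact ⟨y, φ.injective ((φ.commutes y).trans hy)⟩

lemma natDegree_X_sq_add_one (R : Type*) [Field R] : (X ^ 2 + 1 : R[X]).natDegree = 2 := by
  rw [show (X ^ 2 + 1 : R[X]) = X ^ 2 + C 1 by simp, natDegree_X_pow_add_C]

section

variable {R : Type*} [Field R] [Fact (Irreducible (X ^ 2 + 1 : R[X]))]

variable (R) in
lemma not_isSquare_neg_one_of_irreducible : ¬ IsSquare (-1 : R) := by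
  rintro ⟨a, ha⟩
  have h1 := degree_eq_one_of_irreducible_of_root (Fact.out : Irreducible (X ^ 2 + 1 : R[X]))
    (x := a) (by simp [IsRoot, pow_two, ← ha])
  rw [show (X ^ 2 + 1 : R[X]) = X ^ 2 + C 1 by simp, degree_X_pow_add_C two_pos] at h1
  norm_num at h1

lemma AdjoinRoot.root_mul_root :
    root (X ^ 2 + 1 : R[X]) * root (X ^ 2 + 1 : R[X]) = -1 := by
  have := eval₂_root (X ^ 2 + 1 : R[X])
  simp only [eval₂_add, eval₂_pow, eval₂_X, eval₂_one] at this
  linear_combination this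

lemma AdjoinRoot.exists_eq_add_mul_root (w : AdjoinRoot (X ^ 2 + 1 : R[X])) :
    ∃ c d : R, w = of _ c + of _ d * root _ := by
  have hm : (X ^ 2 + 1 : R[X]).Monic := by
    rw [show (X ^ 2 + 1 : R[X]) = X ^ 2 + C 1 by simp]
    exact monic_X_pow_add_C 1 two_ne_zero
  obtain ⟨g, rfl⟩ := mk_surjective w
  obtain ⟨a, b, hab⟩ := exists_eq_X_add_C_of_natDegree_le_one (p := g %ₘ (X ^ 2 + 1 : R[X])) (by
    have := natDegree_modByMonic_lt g hm (by
      intro h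
      have := natDegree_X_sq_add_one R
      simp [h] at this)
    rw [natDegree_X_sq_add_one] at this
    omega)
  refine ⟨b, a, ?_⟩
  conv_lhs => rw [← modByMonic_add_div g (X ^ 2 + 1 : R[X]), hab]
  simp
  ring

lemma AdjoinRoot.eq_of_add_mul_root_eq {a b c d : R}
    (h : of (X ^ 2 + 1) a + of (X ^ 2 + 1) b * root _ = of (X ^ 2 + 1) c + of (X ^ 2 + 1) d * root _) :
    a = c ∧ b = d := by
  have hinj := (of (X ^ 2 + 1 : R[X])).injective
  have hbd : b = d := by
    by_contra hne
    have hne' : b - d ≠ 0 := sub_ne_zero.2 hne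
    refine not_isSquare_neg_one_of_irreducible R ⟨(c - a) / (b - d), hinj ?_⟩
    have hroot : of (X ^ 2 + 1 : R[X]) ((c - a) / (b - d)) = root _ := by
      have h0 : of (X ^ 2 + 1 : R[X]) (b - d) ≠ 0 := (_root_.map_ne_zero _).2 hne'
      rw [map_div₀, div_eq_iff h0, map_sub, map_sub]
      linear_combination -h
    rw [map_mul, hroot, root_mul_root, map_neg, map_one]
  subst hbd
  exact ⟨hinj (by linear_combination h), rfl⟩

variable [IsAlgClosed (AdjoinRoot (X ^ 2 + 1 : R[X]))]

lemma exists_sq_sub_sq_eq (a b : R) : ∃ c d : R, c * c - d * d = a ∧ 2 * (c * d) = b := by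
  obtain ⟨w, hw⟩ := IsAlgClosed.exists_pow_nat_eq
    (AdjoinRoot.of (X ^ 2 + 1) a + AdjoinRoot.of (X ^ 2 + 1) b * AdjoinRoot.root _) two_pos
  obtain ⟨c, d, rfl⟩ := AdjoinRoot.exists_eq_add_mul_root w
  refine ⟨c, d, AdjoinRoot.eq_of_add_mul_root_eq ?_⟩
  rw [← hw]
  simp only [map_sub, map_mul, map_ofNat]
  linear_combination (-AdjoinRoot.of (X ^ 2 + 1) d ^ 2) * AdjoinRoot.root_mul_root (R := R)

variable (R) in
lemma charZero_of_isAlgClosed_adjoinRoot : CharZero R := by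
  obtain ⟨p, hp⟩ := CharP.exists R
  rcases CharP.char_is_prime_or_zero R p with hpp | rfl
  · exfalso
    have := Fact.mk hpp
    obtain ⟨a, b, hab⟩ := ZMod.sq_add_sq p (-1)
    let φ := ZMod.castHom dvd_rfl R
    obtain ⟨c, d, hcd, hcd'⟩ := exists_sq_sub_sq_eq (φ a) (φ b)
    refine not_isSquare_neg_one_of_irreducible R ⟨c * c + d * d, ?_⟩
    have := congr_arg φ hab
    rw [map_add, map_pow, map_pow, map_neg, map_one, ← hcd, ← hcd'] at this
    linear_combination -this
  · exact CharP.charP_to_charZero R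

lemma isSquare_or_isSquare_neg_of_isAlgClosed_adjoinRoot (a : R) :
    IsSquare a ∨ IsSquare (-a) := by
  have := charZero_of_isAlgClosed_adjoinRoot R
  obtain ⟨c, d, rfl, h⟩ := exists_sq_sub_sq_eq a 0
  rcases mul_eq_zero.1 ((mul_eq_zero.1 h).resolve_left two_ne_zero) with rfl | rfl
  · exact .inr ⟨d, by ring⟩
  · exact .inl ⟨c, by ring⟩

end

section

variable {D : Type*} [DivisionRing D]

/-- Elements independent over the centre satisfy no nontrivial relation `∑ cᵢ x dᵢ = 0`. -/
lemma eq_zero_of_forall_sum_mul_mul_eq_zero {ι : Type*} (v : ι → D)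
    (hv : LinearIndependent (Subring.center D) v) (s : Finset ι) (c : ι → D)
    (h : ∀ x, ∑ i ∈ s, c i * x * v i = 0) : ∀ i ∈ s, c i = 0 := by
  classical
  induction s using Finset.induction_on generalizing c with
  | empty => simp
  | insert a s ha ih =>
    by_cases hca : c a = 0
    · simp only [Finset.sum_insert ha, hca, zero_mul, zero_add] at h
      simpa [hca] using ih c h
    exfalso
    have h' : ∀ x, x * v a + ∑ i ∈ s, (c a)⁻¹ * c i * x * v i = 0 := fun x => by
      have := congr_arg ((c a)⁻¹ * ·) (h x)
      simpa [Finset.sum_insert ha, mul_add, Finset.mul_sum, ← mul_assoc, hca] using this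
    have hcomm : ∀ i ∈ s, ∀ d, (c a)⁻¹ * c i * d = d * ((c a)⁻¹ * c i) := fun i hi d => by
      refine sub_eq_zero.1 (ih (fun i => (c a)⁻¹ * c i * d - d * ((c a)⁻¹ * c i)) (fun x => ?_) i hi)
      have h1 := h' (d * x)
      have h2 := congr_arg (d * ·) (h' x)
      simp only [mul_add, Finset.mul_sum, mul_zero, ← mul_assoc] at h1 h2
      simp only [sub_mul, Finset.sum_sub_distrib, ← mul_assoc]
      rw [sub_eq_zero]
      exact add_left_cancel (h1.trans h2.symm)
    have hz : ∀ i ∈ s, (c a)⁻¹ * c i ∈ Subring.center D := fun i hi =>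
      Subring.mem_center_iff.2 fun d => (hcomm i hi d).symm
    have hrel := linearIndependent_iff'.1 hv (insert a s)
      (fun i => if hi : i ∈ s then ⟨(c a)⁻¹ * c i, hz i hi⟩ else 1) (by
        rw [Finset.sum_insert ha, dif_neg ha, one_smul, ← h' 1]
        simp only [one_mul, mul_one]
        congr 1
        refine Finset.sum_congr rfl fun i hi => ?_
        rw [dif_pos hi]
        rfl) a (Finset.mem_insert_self a s)
    rw [dif_neg ha] at hrel
    exact one_ne_zero hrel

/-- A division ring of finite left dimension over a subfield has finite dimension over its
centre. -/
theorem finiteDimensional_center {R : Type*} [Field R] (f : R →+* D) [Module R D]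
    (hsmul : ∀ (r : R) (x : D), r • x = f r * x) [FiniteDimensional R D] :
    FiniteDimensional (Subring.center D) D := by
  let ρ : D → (D →ₗ[R] D) := fun d =>
    { toFun := fun x => x * d
      map_add' := fun x y => add_mul x y d
      map_smul' := fun r x => by simp [hsmul, mul_assoc] }
  have hrank := rank_le (R := Subring.center D) (M := D) (n := Module.finrank R (D →ₗ[R] D))
    fun s hs => by
      have hρ : LinearIndependent R fun i : s => ρ i := by
        rw [Fintype.linearIndependent_iff]
        intro g hg i
        refine (map_eq_zero f).1 (eq_zero_of_forall_sum_mul_mul_eq_zero _ hs Finset.univ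
          (fun i => f (g i)) (fun x => ?_) i (Finset.mem_univ i))
        have := LinearMap.congr_fun hg x
        simpa [ρ, hsmul, mul_assoc] using this
      simpa using hρ.fintype_card_le_finrank
  exact Module.rank_lt_aleph0_iff.1 (hrank.trans_lt (Cardinal.natCast_lt_aleph0))

/-- The field structure on a finite-dimensional commutative subalgebra of a division ring. -/
noncomputable abbrev Subalgebra.fieldOfForallMulComm {Z : Type*} [Field Z] [Algebra Z D] [FiniteDimensional Z D]
    (S : Subalgebra Z D) (hS : ∀ a b : S, a * b = b * a) : Field S :=
  letI : CommRing S := { (inferInstance : Ring S) with mul_comm := hS }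
  fieldOfFiniteDimensional Z S

lemma isSquare_of_finiteDimensional_center [CharZero D] [FiniteDimensional (Subring.center D) D]
    (Ω : Type*) [Field Ω] [IsAlgClosed Ω] [Algebra (Subring.center D) Ω]
    [FiniteDimensional (Subring.center D) Ω] (hD : ¬ ∀ a b : D, a * b = b * a) (d : D) :
    IsSquare d := by
  have : CharZero (Subring.center D) := by
    refine ⟨fun a b h => Nat.cast_injective (R := D) ?_⟩
    exact_mod_cast congr_arg Subtype.val h
  have key : ∀ y : D, y ∉ Subring.center D → d ∈ Algebra.adjoin (Subring.center D) {y} →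
      IsSquare d := by
    intro y hy hd
    have hcomm : ∀ a b : Algebra.adjoin (Subring.center D) {y}, a * b = b * a := fun a b =>
      Subtype.ext (Algebra.commute_of_mem_adjoin_singleton_of_commute b.2
        (Algebra.commute_of_mem_adjoin_self a.2).symm)
    let := (Algebra.adjoin (Subring.center D) {y}).fieldOfForallMulComm hcomm
    rcases surjective_algebraMap_or_isAlgClosed (Subring.center D) Ω
      (Algebra.adjoin (Subring.center D) {y}) with h | h
    · obtain ⟨z, hz⟩ := h ⟨y, Algebra.self_mem_adjoin_singleton _ y⟩
      have hzy : (z : D) = y := congr_arg Subtype.val hz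
      exact (hy (hzy ▸ z.2)).elim
    · obtain ⟨z, hz⟩ := IsAlgClosed.exists_pow_nat_eq
        (⟨d, hd⟩ : Algebra.adjoin (Subring.center D) {y}) two_pos
      rw [pow_two] at hz
      exact ⟨z, (congr_arg Subtype.val hz).symm⟩
  by_cases hd : d ∈ Subring.center D
  · obtain ⟨y, hy⟩ : ∃ y, y ∉ Subring.center D := by
      by_contra! h
      exact hD fun a b => (Subring.mem_center_iff.1 (h b) a)
    exact key y hy (Subalgebra.algebraMap_mem _ (⟨d, hd⟩ : Subring.center D))
  · exact key d hd (Algebra.self_mem_adjoin_singleton _ d)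

end

section

variable {R : Type*} [Field R] [Fact (Irreducible (X ^ 2 + 1 : R[X]))]

variable (R) in
lemma finiteDimensional_adjoinRoot_X_sq_add_one :
    FiniteDimensional R (AdjoinRoot (X ^ 2 + 1 : R[X])) :=
  (AdjoinRoot.powerBasis (Fact.out : Irreducible (X ^ 2 + 1 : R[X])).ne_zero).finite

variable [IsAlgClosed (AdjoinRoot (X ^ 2 + 1 : R[X]))]

lemma isSquare_of_not_commutative {D : Type*} [DivisionRing D] (f : R →+* D) [Module R D]
    (hsmul : ∀ (r : R) (x : D), r • x = f r * x) [FiniteDimensional R D]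
    (hD : ¬ ∀ a b : D, a * b = b * a) (d : D) : IsSquare d := by
  have := charZero_of_isAlgClosed_adjoinRoot R
  have : CharZero D := charZero_of_injective_ringHom f.injective
  have := finiteDimensional_adjoinRoot_X_sq_add_one R
  have := finiteDimensional_center f hsmul
  let S : Subalgebra (Subring.center D) D := Algebra.adjoin (Subring.center D) (Set.range f)
  have hS : ∀ a b : S, a * b = b * a := by
    have := Algebra.isMulCommutative_adjoin (Subring.center D) (s := Set.range f) (by
      rintro _ ⟨a, rfl⟩ _ ⟨b, rfl⟩
      rw [← map_mul, mul_comm, map_mul])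
    exact fun a b => this.is_comm.comm a b
  let := S.fieldOfForallMulComm hS
  let g : R →+* S := f.codRestrict S fun r => Algebra.subset_adjoin ⟨r, rfl⟩
  let : Algebra R S := g.toAlgebra
  have : FiniteDimensional R S := Module.Finite.of_injective
    ({ toFun := Subtype.val
       map_add' := fun _ _ => rfl
       map_smul' := fun r x => (hsmul r x).symm } : S →ₗ[R] D) Subtype.val_injective
  rcases surjective_algebraMap_or_isAlgClosed R (AdjoinRoot (X ^ 2 + 1 : R[X])) S with h | h
  · let e : R ≃+* S := RingEquiv.ofBijective g ⟨g.injective, h⟩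
    let φ : Subring.center D →+* AdjoinRoot (X ^ 2 + 1 : R[X]) :=
      ((algebraMap R _).comp e.symm.toRingHom).comp (algebraMap (Subring.center D) S)
    have hφ : φ.Finite := RingHom.Finite.comp
      (RingHom.Finite.comp (RingHom.finite_algebraMap.2 inferInstance)
        (RingHom.Finite.of_surjective _ e.symm.surjective))
      (RingHom.finite_algebraMap.2 inferInstance)
    let := φ.toAlgebra
    have : FiniteDimensional (Subring.center D) (AdjoinRoot (X ^ 2 + 1 : R[X])) := hφ
    exact isSquare_of_finiteDimensional_center (AdjoinRoot (X ^ 2 + 1 : R[X])) hD d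
  · exact isSquare_of_finiteDimensional_center S hD d

lemma isSquare_or_isSquare_neg_of_finiteDimensional {K : Type*} [Field K] (f : R →+* K)
    [Module R K] (hsmul : ∀ (r : R) (x : K), r • x = f r * x) [FiniteDimensional R K] (d : K) :
    IsSquare d ∨ IsSquare (-d) := by
  have := charZero_of_isAlgClosed_adjoinRoot R
  have := finiteDimensional_adjoinRoot_X_sq_add_one R
  let : Algebra R K := { f.toAlgebra with
    toSMul := inferInstance
    smul_def' := hsmul }
  have : FiniteDimensional R K := by
    convert ‹FiniteDimensional R K›
  rcases surjective_algebraMap_or_isAlgClosed R (AdjoinRoot (X ^ 2 + 1 : R[X])) K with h | h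
  · obtain ⟨a, rfl⟩ := h d
    rcases isSquare_or_isSquare_neg_of_isAlgClosed_adjoinRoot a with h | h
    · exact .inl (h.map _)
    · exact .inr (by simpa using h.map (algebraMap R K))
  · obtain ⟨z, hz⟩ := IsAlgClosed.exists_pow_nat_eq d two_pos
    exact .inl ⟨z, by rw [← hz, pow_two]⟩

end

lemma Matrix.det_eq_one_of_mem_commutator {K : Type*} [Field K] {m : Type*} [Fintype m]
    [DecidableEq m] {A : (Matrix m m K)ˣ} (hA : A ∈ commutator (Matrix m m K)ˣ) :
    A.val.det = 1 := by
  have := Abelianization.commutator_subset_ker (Units.map (detMonoidHom (n := m) (R := K))) hA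
  exact congr_arg Units.val this

section

open Matrix

/-- `a = m² s²` with `m`, `s`, `1 + m`, `1 + s` all invertible. -/
def IsRegularSquareProduct {S : Type*} [Ring S] (a : S) : Prop :=
  ∃ m s : Sˣ, IsUnit (1 + (m : S)) ∧ IsUnit (1 + (s : S)) ∧ a = m * m * (s * s)

lemma IsRegularSquareProduct.map {S T F : Type*} [Ring S] [Ring T] [FunLike F S T]
    [RingHomClass F S T] (φ : F) {a : S} (h : IsRegularSquareProduct a) :
    IsRegularSquareProduct (φ a) := by
  obtain ⟨m, s, hm, hs, rfl⟩ := h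
  refine ⟨Units.map (φ : S →* T) m, Units.map (φ : S →* T) s, ?_, ?_, by simp⟩
  · simpa using hm.map φ
  · simpa using hs.map φ

lemma IsRegularSquareProduct.conj {S : Type*} [Ring S] {a : S} (p : Sˣ)
    (h : IsRegularSquareProduct (p * a * ↑p⁻¹)) : IsRegularSquareProduct a := by
  have := h.map (MulSemiringAction.toRingHom (ConjAct Sˣ) S (ConjAct.toConjAct p⁻¹))
  simpa [ConjAct.units_smul_def, mul_assoc] using this

section Blocks

variable {m : Type} [Fintype m] [DecidableEq m] {l : Type} [Fintype l] [DecidableEq l]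

lemma isUnit_fromBlocks_zero₁₂ {S : Type*} [Ring S] {A : Matrix l l S} {B : Matrix m m S}
    (hA : IsUnit A) (hB : IsUnit B) (C : Matrix m l S) : IsUnit (fromBlocks A 0 C B) := by
  obtain ⟨A, rfl⟩ := hA
  obtain ⟨B, rfl⟩ := hB
  refine ⟨⟨fromBlocks A.val 0 C B.val, fromBlocks A⁻¹.val 0 (-(B⁻¹.val * C * A⁻¹.val)) B⁻¹.val, ?_, ?_⟩, rfl⟩
  · simp [fromBlocks_multiply, ← Matrix.mul_assoc, fromBlocks_one]
  · simp [fromBlocks_multiply, Matrix.mul_assoc, fromBlocks_one]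

lemma isUnit_fromBlocks_zero₂₁ {S : Type*} [Ring S] {A : Matrix l l S} {B : Matrix m m S}
    (hA : IsUnit A) (hB : IsUnit B) (C : Matrix l m S) : IsUnit (fromBlocks A C 0 B) := by
  obtain ⟨A, rfl⟩ := hA
  obtain ⟨B, rfl⟩ := hB
  refine ⟨⟨fromBlocks A.val C 0 B.val, fromBlocks A⁻¹.val (-(A⁻¹.val * C * B⁻¹.val)) 0 B⁻¹.val, ?_, ?_⟩, rfl⟩
  · simp [fromBlocks_multiply, ← Matrix.mul_assoc, fromBlocks_one]
  · simp [fromBlocks_multiply, Matrix.mul_assoc, fromBlocks_one]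

lemma fromBlocks_one_eq_mul {S : Type*} [Ring S] (r : Matrix l m S) (c : Matrix m l S)
    (B : Matrix m m S) : fromBlocks 1 r c B =
      fromBlocks 1 0 c 1 * fromBlocks 1 0 0 (B - c * r) * fromBlocks 1 r 0 1 := by
  simp [fromBlocks_multiply]

lemma isUnit_schurComplement {S : Type*} [Ring S] {r : Matrix l m S} {c : Matrix m l S}
    {B : Matrix m m S} (h : IsUnit (fromBlocks 1 r c B)) : IsUnit (B - c * r) := by
  obtain ⟨P, hP⟩ := isUnit_fromBlocks_zero₂₁ isUnit_one isUnit_one r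
  obtain ⟨Q, hQ⟩ := isUnit_fromBlocks_zero₁₂ isUnit_one isUnit_one c
  rw [fromBlocks_one_eq_mul, ← hP, ← hQ, Units.isUnit_mul_units, Units.isUnit_units_mul] at h
  obtain ⟨⟨u, v, huv, hvu⟩, rfl : u = _⟩ := h
  rw [← fromBlocks_toBlocks v] at huv hvu
  rw [← fromBlocks_one, fromBlocks_multiply, fromBlocks_inj] at huv hvu
  exact ⟨⟨_, v.toBlocks₂₂, by simpa using huv.2.2.2, by simpa using hvu.2.2.2⟩, rfl⟩

lemma IsRegularSquareProduct.of_schurComplement {S : Type*} [Ring S] (h2 : IsUnit (2 : S))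
    {r : Matrix l m S} {c : Matrix m l S} {B : Matrix m m S}
    (h : IsRegularSquareProduct (B - c * r)) : IsRegularSquareProduct (fromBlocks 1 r c B) := by
  obtain ⟨M, N, ⟨M', hM⟩, ⟨N', hN⟩, h⟩ := h
  have h2' : IsUnit (1 + 1 : Matrix l l S) := by
    have := h2.map (Matrix.scalar l)
    rwa [← one_add_one_eq_two, map_add, map_one] at this
  have hy : M'⁻¹.val * c + M.val * (M'⁻¹.val * c) = c := by
    have : (1 + M.val) * (M'⁻¹.val * c) = c := by rw [← hM, ← Matrix.mul_assoc]; simp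
    simpa [Matrix.add_mul] using this
  have hx : r * N'⁻¹.val + r * N'⁻¹.val * N.val = r := by
    have : r * N'⁻¹.val * (1 + N.val) = r := by rw [← hN, Matrix.mul_assoc]; simp
    simpa [Matrix.mul_add] using this
  refine ⟨(isUnit_fromBlocks_zero₁₂ isUnit_one M.isUnit (M'⁻¹.val * c)).unit,
    (isUnit_fromBlocks_zero₂₁ isUnit_one N.isUnit (r * N'⁻¹.val)).unit, ?_, ?_, ?_⟩
  · rw [IsUnit.unit_spec, ← fromBlocks_one, fromBlocks_add, add_zero]
    exact isUnit_fromBlocks_zero₁₂ h2' ⟨M', hM⟩ _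
  · rw [IsUnit.unit_spec, ← fromBlocks_one, fromBlocks_add, add_zero]
    exact isUnit_fromBlocks_zero₂₁ h2' ⟨N', hN⟩ _
  · simp only [IsUnit.unit_spec, fromBlocks_multiply]
    simp [hx, hy, ← h]

end Blocks

/-- `A` has Dieudonné determinant represented by some `d`, and any admissible square root of `d`
exhibits `A` as a regular product of two squares. -/
def SquareReducible {D : Type u} [DivisionRing D] {m : Type} [Fintype m] [DecidableEq m]
    (A : Matrix m m D) : Prop :=
  ∃ d : D, (∀ (K : Type u) [Field K] (φ : D →+* K), (A.map φ).det = φ d) ∧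
    ∀ e : D, e * e = d → 1 + e ≠ 0 → IsRegularSquareProduct A

section

variable {D : Type u} [DivisionRing D] {m : Type} [Fintype m] [DecidableEq m]

lemma SquareReducible.conj {A : Matrix m m D} (P : (Matrix m m D)ˣ)
    (h : SquareReducible (P.val * A * P⁻¹.val)) : SquareReducible A := by
  obtain ⟨d, hd, he⟩ := h
  refine ⟨d, fun K _ φ => ?_, fun e h1 h2 => (he e h1 h2).conj P⟩
  rw [← hd K φ, Matrix.map_mul, Matrix.map_mul, det_mul, det_mul, mul_right_comm, ← det_mul,
    ← Matrix.map_mul, Units.mul_inv]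
  simp

lemma SquareReducible.of_reindex {l : Type} [Fintype l] [DecidableEq l] {A : Matrix m m D}
    (e : m ≃ l) (h : SquareReducible (A.reindex e e)) : SquareReducible A := by
  obtain ⟨d, hd, he⟩ := h
  refine ⟨d, fun K _ φ => ?_, fun x h1 h2 => ?_⟩
  · rw [← hd K φ, reindex_apply, ← submatrix_map, det_submatrix_equiv_self]
  · have := (he x h1 h2).map (reindexAlgEquiv ℕ D e.symm)
    simpa using this

lemma SquareReducible.of_schurComplement (h2 : (2 : D) ≠ 0) {l : Type} [Fintype l] [DecidableEq l]
    {r : Matrix l m D} {c : Matrix m l D} {B : Matrix m m D}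
    (h : SquareReducible (B - c * r)) : SquareReducible (fromBlocks 1 r c B) := by
  obtain ⟨d, hd, he⟩ := h
  refine ⟨d, fun K _ φ => ?_, fun x hx hx' => (he x hx hx').of_schurComplement h2.isUnit⟩
  rw [← hd K φ, fromBlocks_map, Matrix.map_one _ φ.map_zero φ.map_one, det_fromBlocks_one₁₁,
    Matrix.map_sub _ (by simp), Matrix.map_mul]

lemma SquareReducible.of_unique (h2 : (2 : D) ≠ 0) [Unique m] {A : Matrix m m D} (hA : IsUnit A) :
    SquareReducible A := by
  have hA' : A = Matrix.scalar m (A default default) := by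
    ext i j
    simp [Unique.eq_default i, Unique.eq_default j]
  refine ⟨A default default, fun K _ φ => by simp, fun e h1 he => ?_⟩
  have he0 : e ≠ 0 := by
    rintro rfl
    rw [hA', ← h1] at hA
    simp at hA
  rw [hA', ← h1]
  refine IsRegularSquareProduct.map (Matrix.scalar m) ⟨1, Units.mk0 e he0, ?_, ?_, by simp⟩
  · simpa [one_add_one_eq_two] using h2
  · simpa using he

end

lemma exists_apply_default_ne_zero {D m l : Type*} [Zero D] [Unique l] {c : Matrix m l D} (hc : c ≠ 0) :
    ∃ j, c j default ≠ 0 := by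
  by_contra! h
  refine hc (ext fun i k => ?_)
  rw [Unique.eq_default k, h, Matrix.zero_apply]

section

variable {D : Type u} [DivisionRing D] {m : Type} [Fintype m] [DecidableEq m]

lemma exists_conj_apply_ne_zero [Nontrivial m] {A : Matrix m m D}
    (hA : A ∉ Subring.center (Matrix m m D)) :
    ∃ P : (Matrix m m D)ˣ, ∃ i j, i ≠ j ∧ (P.val * A * P⁻¹.val) i j ≠ 0 := by
  by_contra! h
  have h0 : ∀ i j, i ≠ j → A i j = 0 := fun i j hij => by simpa using h 1 i j hij
  have hdiag : A = diagonal fun i => A i i := by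
    ext i j
    by_cases hij : i = j
    · simp [hij]
    · rw [diagonal_apply_ne _ hij, h0 i j hij]
  have h1 : ∀ i j, i ≠ j → ∀ d, d * A j j = A i i * d := fun i j hij d => by
    have hsq : single i j d * single i j d = 0 := single_mul_single_of_ne _ _ _ _ hij.symm _
    have := h ⟨1 + single i j d, 1 - single i j d, by simp [mul_sub, add_mul, hsq],
      by simp [sub_mul, mul_add, hsq]⟩ i j hij
    rw [hdiag] at this
    simpa [add_mul, mul_sub, hij, hij.symm, sub_eq_zero, Matrix.mul_assoc, single_apply,
      diagonal_apply] using this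
  refine hA (Subring.mem_center_iff.2 fun M => ?_)
  ext i j
  rw [hdiag, mul_diagonal, diagonal_mul]
  by_cases hij : i = j
  · subst hij
    obtain ⟨k, hk⟩ := exists_ne i
    rw [← h1 i k hk.symm, show A i i = A k k by simpa using (h1 i k hk.symm 1).symm]
  · exact h1 i j hij _

variable {l : Type} [Fintype l] [DecidableEq l]

/-- The block upper unitriangular matrix with off-diagonal block `q`. -/
def upperShear (q : Matrix l m D) : (Matrix (l ⊕ m) (l ⊕ m) D)ˣ where
  val := fromBlocks 1 q 0 1
  inv := fromBlocks 1 (-q) 0 1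
  val_inv := by simp [fromBlocks_multiply, fromBlocks_one]
  inv_val := by simp [fromBlocks_multiply, fromBlocks_one]

lemma upperShear_conj (q : Matrix l m D) (a : Matrix l l D) (r : Matrix l m D) (c : Matrix m l D)
    (B : Matrix m m D) :
    (upperShear q).val * fromBlocks a r c B * (upperShear q)⁻¹.val =
      fromBlocks (a + q * c) (r + q * B - (a + q * c) * q) c (B - c * q) := by
  simp only [upperShear, Units.inv_mk, fromBlocks_multiply, fromBlocks_inj]
  refine ⟨by simp, ?_, by simp, ?_⟩ <;> simp <;> abel

lemma exists_mul_ne_central {l : Type} [Fintype l] [Unique l] [Nontrivial m] {c : Matrix m l D} (hc : c ≠ 0)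
    {B : Matrix m m D} (hB : IsUnit B) :
    ∃ q : Matrix l m D, q * c = 0 ∧ B + c * q * B ∉ Subring.center (Matrix m m D) := by
  by_cases hBc : B ∈ Subring.center (Matrix m m D)
  · obtain ⟨j, hj⟩ := exists_apply_default_ne_zero hc
    obtain ⟨k, hk⟩ := exists_ne j
    refine ⟨of fun _ x => (Pi.single k 1 - Pi.single j (c k default * (c j default)⁻¹) : m → D) x,
      ?_, fun h => ?_⟩
    · ext x y
      rw [Unique.eq_default y]
      simp [mul_apply, sub_mul, Finset.sum_sub_distrib, Pi.single_apply, ite_mul, hj]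
    · obtain ⟨B, rfl⟩ := hB
      replace h := sub_mem h hBc
      rw [add_sub_cancel_left] at h
      have hinv : B⁻¹.val ∈ Subring.center (Matrix m m D) := by
        rw [Subring.mem_center_iff] at hBc ⊢
        exact fun g => (Commute.units_inv_right (hBc g : Commute g B)).eq
      have h' := mul_mem h hinv
      rw [mul_assoc, Units.mul_inv, mul_one, Matrix.subringCenter_eq_scalar_map] at h'
      obtain ⟨x, -, hx⟩ := h'
      have := congr_fun₂ hx j k
      simp [mul_apply, hk, hk.symm] at this
      exact hj this.symm
  · exact ⟨0, by simp, by simpa using hBc⟩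

lemma SquareReducible.of_fromBlocks (h2 : (2 : D) ≠ 0) [Unique l] [Nonempty m]
    (ih : ∀ B : Matrix m m D, IsUnit B →
      (Nontrivial m → B ∉ Subring.center (Matrix m m D)) → SquareReducible B)
    {a : Matrix l l D} {r : Matrix l m D} {c : Matrix m l D} {B : Matrix m m D}
    (hA : IsUnit (fromBlocks a r c B)) (hc : c ≠ 0) : SquareReducible (fromBlocks a r c B) := by
  wlog ha : a = 1 generalizing a r c B
  · obtain ⟨j, hj⟩ := exists_apply_default_ne_zero hc
    set q : Matrix l m D := of fun _ => Pi.single j ((1 - a default default) * (c j default)⁻¹)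
    have hq : a + q * c = 1 := by
      ext x y
      rw [Unique.eq_default x, Unique.eq_default y]
      simp [q, mul_apply, Pi.single_apply, hj]
    refine SquareReducible.conj (upperShear q) ?_
    have hu : IsUnit ((upperShear q).val * fromBlocks a r c B * (upperShear q)⁻¹.val) := by
      simpa using hA
    rw [upperShear_conj] at hu ⊢
    exact this hu hc hq
  subst ha
  have hS := isUnit_schurComplement hA
  rcases subsingleton_or_nontrivial m with hm | hm
  · exact (ih _ hS fun h => (not_nontrivial m h).elim).of_schurComplement h2
  · obtain ⟨q, hqc, hq⟩ := exists_mul_ne_central hc hS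
    refine SquareReducible.conj (upperShear (-q)) ?_
    have hu : IsUnit ((upperShear (-q)).val * fromBlocks 1 r c B * (upperShear (-q))⁻¹.val) := by
      simpa using hA
    rw [upperShear_conj] at hu ⊢
    simp only [Matrix.neg_mul, hqc, neg_zero, add_zero] at hu ⊢
    refine (ih _ (isUnit_schurComplement hu) fun _ => ?_).of_schurComplement h2
    convert hq using 1
    simp only [Matrix.mul_sub, Matrix.mul_add, Matrix.mul_neg, Matrix.one_mul, Matrix.mul_assoc]
    rw [← Matrix.mul_assoc q c r, hqc]
    simp
    abel_nf

theorem squareReducible_of_notMem_center (h2 : (2 : D) ≠ 0) (k : ℕ) :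
    ∀ (m : Type) [Fintype m] [DecidableEq m], Fintype.card m = k + 1 → ∀ A : Matrix m m D,
      IsUnit A → (Nontrivial m → A ∉ Subring.center (Matrix m m D)) → SquareReducible A := by
  induction k with
  | zero =>
    intro m _ _ hm A hA _
    have := (Fintype.card_eq_one_iff_nonempty_unique.1 hm).some
    exact .of_unique h2 hA
  | succ k ih =>
    intro m _ _ hm A hA hAc
    have hnt : Nontrivial m := Fintype.one_lt_card_iff_nontrivial.1 (by omega)
    obtain ⟨P, i, j, hij, hP⟩ := exists_conj_apply_ne_zero (hAc hnt)
    refine SquareReducible.conj P ?_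
    have hu : IsUnit (P.val * A * P⁻¹.val) := by simpa using hA
    generalize P.val * A * P⁻¹.val = A' at hP hu
    refine SquareReducible.of_reindex (Equiv.sumCompl (· = j)).symm ?_
    have hu' := hu.map (reindexAlgEquiv ℕ D (Equiv.sumCompl (· = j)).symm)
    rw [coe_reindexAlgEquiv] at hu'
    have hcard : Fintype.card {x // ¬ x = j} = k + 1 := by
      rw [Fintype.card_subtype_compl, Fintype.card_subtype_eq, hm]; rfl
    have : Nonempty {x // ¬ x = j} := ⟨i, hij⟩
    rw [← fromBlocks_toBlocks (reindex _ _ A')] at hu' ⊢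
    refine SquareReducible.of_fromBlocks h2 (ih _ hcard) hu' fun h => hP ?_
    exact congr_fun₂ h ⟨i, hij⟩ ⟨j, rfl⟩

end

section

variable {D : Type u} [DivisionRing D]

lemma IsRegularSquareProduct.exists_eq_sq_mul_sq {S : Type*} [Ring S] {a : Sˣ}
    (h : IsRegularSquareProduct (a : S)) : ∃ x y : Sˣ, a = x ^ 2 * y ^ 2 := by
  obtain ⟨x, y, -, -, h⟩ := h
  exact ⟨x, y, Units.ext (by simpa [pow_two] using h)⟩

lemma SquareReducible.isRegularSquareProduct (h2 : (2 : D) ≠ 0) {m : Type} [Fintype m]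
    [DecidableEq m] {A : Matrix m m D} (h : SquareReducible A)
    (hsq : ∀ d : D, (∀ (K : Type u) [Field K] (φ : D →+* K), (A.map φ).det = φ d) → IsSquare d) :
    IsRegularSquareProduct A := by
  obtain ⟨d, hd, he⟩ := h
  obtain ⟨e, rfl⟩ := hsq d hd
  by_cases h1 : 1 + e = 0
  · refine he 1 ?_ (by rwa [one_add_one_eq_two])
    rw [eq_neg_of_add_eq_zero_right h1]
    simp
  · exact he e rfl h1

/-- An invertible matrix over a division ring in which every element is a square is a product of
two squares. -/
theorem exists_eq_sq_mul_sq_of_forall_isSquare (h2 : (2 : D) ≠ 0) (hD : ∀ d : D, IsSquare d)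
    {n : ℕ} (A : (Matrix (Fin n) (Fin n) D)ˣ) :
    ∃ X Y : (Matrix (Fin n) (Fin n) D)ˣ, A = X ^ 2 * Y ^ 2 := by
  by_cases hA : A.val ∈ Subring.center (Matrix (Fin n) (Fin n) D)
  · rw [Matrix.subringCenter_eq_scalar_map] at hA
    obtain ⟨x, -, hx⟩ := hA
    obtain ⟨y, rfl⟩ := hD x
    rcases eq_or_ne y 0 with rfl | hy
    · refine ⟨A, 1, Units.ext ?_⟩
      simp [pow_two, ← hx]
    · refine ⟨Units.map (Matrix.scalar (Fin n)).toMonoidHom (Units.mk0 y hy), 1, Units.ext ?_⟩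
      rw [← hx]
      simp [pow_two]
  · obtain _ | n := n
    · exact ⟨1, 1, Subsingleton.elim _ _⟩
    · exact ((squareReducible_of_notMem_center h2 n _ (by simp) A.val A.isUnit
        fun _ => hA).isRegularSquareProduct h2 fun d _ => hD d).exists_eq_sq_mul_sq

/-- Over a field in which every element is a square up to sign, every matrix of determinant one is
a product of two squares. -/
theorem exists_eq_sq_mul_sq_of_det_eq_one {K : Type u} [Field K] (h2 : (2 : K) ≠ 0)
    (hK : ∀ d : K, IsSquare d ∨ IsSquare (-d)) {n : ℕ} (A : (Matrix (Fin n) (Fin n) K)ˣ)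
    (hdet : A.val.det = 1) : ∃ X Y : (Matrix (Fin n) (Fin n) K)ˣ, A = X ^ 2 * Y ^ 2 := by
  obtain _ | k := n
  · exact ⟨1, 1, Subsingleton.elim _ _⟩
  by_cases hA : Nontrivial (Fin (k + 1)) →
      A.val ∉ Subring.center (Matrix (Fin (k + 1)) (Fin (k + 1)) K)
  · refine ((squareReducible_of_notMem_center h2 k _ (by simp) A.val A.isUnit
        hA).isRegularSquareProduct h2 fun d hd => ?_).exists_eq_sq_mul_sq
    have := hd K (RingHom.id K)
    rw [RingHom.id_apply] at this
    exact ⟨1, by simpa [hdet] using this.symm⟩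
  · push Not at hA
    have hA := hA.2
    rw [Matrix.subringCenter_eq_scalar_map] at hA
    obtain ⟨x, -, hx⟩ := hA
    have hxn : x ^ (k + 1) = 1 := by
      rw [← hdet, ← hx]
      simp
    have key : ∀ y (J : (Matrix (Fin (k + 1)) (Fin (k + 1)) K)ˣ),
        A.val = scalar (Fin (k + 1)) (y * y) * (J.val * J.val) →
        ∃ X Y : (Matrix (Fin (k + 1)) (Fin (k + 1)) K)ˣ, A = X ^ 2 * Y ^ 2 := by
      intro y J h
      have hy : y ≠ 0 := by
        rintro rfl
        rw [h] at hdet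
        simp at hdet
      refine ⟨Units.map (Matrix.scalar (Fin (k + 1))).toMonoidHom (Units.mk0 y hy), J, Units.ext ?_⟩
      rw [h]
      simp [pow_two]
    rcases Nat.even_or_odd k with ⟨j, hj⟩ | ⟨j, hj⟩
    · refine key (x ^ (j + 1)) 1 ?_
      rw [← hx, ← pow_add, show j + 1 + (j + 1) = k + 1 + 1 by omega, pow_succ, hxn]
      simp
    · rcases hK x with ⟨y, hy⟩ | ⟨y, hy⟩
      · exact key y 1 (by simp [← hx, hy])
      · let e : Fin (j + 1) ⊕ Fin (j + 1) ≃ Fin (k + 1) :=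
          finSumFinEquiv.trans (finCongr (by omega))
        let J₀ : Matrix (Fin (j + 1) ⊕ Fin (j + 1)) (Fin (j + 1) ⊕ Fin (j + 1)) K :=
          fromBlocks 0 (-1) 1 0
        have hJ₀ : J₀ * J₀ = -1 := by
          simp [J₀, fromBlocks_multiply, ← fromBlocks_one, fromBlocks_neg]
        have hJ : reindexAlgEquiv K K e J₀ * reindexAlgEquiv K K e J₀ = -1 := by
          rw [← map_mul, hJ₀, map_neg, map_one]
        refine key y ⟨reindexAlgEquiv K K e J₀, -reindexAlgEquiv K K e J₀, by rw [mul_neg, hJ, neg_neg],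
          by rw [neg_mul, hJ, neg_neg]⟩ ?_
        dsimp only
        rw [hJ, ← hx, ← hy]
        simp

end

end

/-- If D is a division ring containing a real-closed field R (R not algebraically
    closed, but R(√-1) algebraically closed) with dim_R D < ∞, then every element of
    SLₙ(D) (the commutator subgroup of GLₙ(D)) is a product of two squares in GLₙ(D). -/
theorem stmt_18 (R D : Type*) [Field R] [DivisionRing D]
    [Fact (Irreducible (X ^ 2 + 1 : Polynomial R))]
    (hnac : ¬ IsAlgClosed R)
    (hac : IsAlgClosed (AdjoinRoot (X ^ 2 + 1 : Polynomial R)))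
    (f : R →+* D) [Module R D] (hsmul : ∀ (r : R) (x : D), r • x = f r * x)
    (hfin : FiniteDimensional R D)
    {n : ℕ} (A : (Matrix (Fin n) (Fin n) D)ˣ)
    (hA : A ∈ commutator (Matrix (Fin n) (Fin n) D)ˣ) :
    ∃ X Y : (Matrix (Fin n) (Fin n) D)ˣ, A = X ^ 2 * Y ^ 2 := by
  have := charZero_of_isAlgClosed_adjoinRoot R
  have : CharZero D := charZero_of_injective_ringHom f.injective
  by_cases hD : ∀ a b : D, a * b = b * a
  · let : Field D := { ‹DivisionRing D› with mul_comm := hD }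
    exact exists_eq_sq_mul_sq_of_det_eq_one two_ne_zero
      (isSquare_or_isSquare_neg_of_finiteDimensional f hsmul) A
      (Matrix.det_eq_one_of_mem_commutator hA)
  · exact exists_eq_sq_mul_sq_of_forall_isSquare two_ne_zero
      (isSquare_of_not_commutative f hsmul hD) A
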